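/- arXiv:1103.0136 — 3 statements merged into one kernel-verified Lean document; each statement's English description precedes it below -/
import Mathlib

section
/- Let p : ℕ × ℕ → [0,1] be a Markov transition matrix (∑_y p(x,y) = 1 for every x) that is irreducible (for all x,y there exists n ≥ 1 with pⁿ(x,y) > 0) and reversible with respect to a strictly positive probability measure π on ℕ (i.e. p(x,y)π(x) = p(y,x)π(y) for all x,y). Let P denote the induced self-adjoint contraction on L²(π), Pf(x) = ∑_y p(x,y) f(y). For x ∈ ℕ set λ̂₀^(x) := sup{⟨Pf,f⟩_π : f ∈ L²(π), f(x) = 0, ||f||_π = 1}. If there exists x ∈ ℕ with λ̂₀^(x) = 1, then 1 is not an isolated point of the spectrum of P. -/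
open scoped InnerProductSpace ENNReal

/-- The `n`-step transition probabilities of the kernel `p`. -/
noncomputable def kernelPow (p : ℕ → ℕ → ℝ) : ℕ → ℕ → ℕ → ℝ
  | 0 => fun x y => if x = y then 1 else 0
  | n + 1 => fun x y => ∑' z : ℕ, kernelPow p n x z * p z y

section abstractPart
variable {H : Type*} [NormedAddCommGroup H] [InnerProductSpace ℝ H]

lemma form_cs (B : H →L[ℝ] H) (hsym : ∀ f g, ⟪B f, g⟫_ℝ = ⟪f, B g⟫_ℝ)
    (hpos : ∀ f, 0 ≤ ⟪B f, f⟫_ℝ) (f g : H) :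
    ⟪B f, g⟫_ℝ ^ 2 ≤ ⟪B f, f⟫_ℝ * ⟪B g, g⟫_ℝ := by
  have h := LinearMap.BilinForm.apply_mul_apply_le_of_forall_zero_le
    ((innerₗ H) ∘ₗ (B : H →ₗ[ℝ] H)) (fun f => by simpa using hpos f) f g
  simp only [LinearMap.comp_apply, innerₗ_apply_apply, ContinuousLinearMap.coe_coe] at h
  rw [hsym g f, real_inner_comm (B f) g] at h
  rw [sq]; exact h

lemma form_sq_le (B : H →L[ℝ] H) (hsym : ∀ f g, ⟪B f, g⟫_ℝ = ⟪f, B g⟫_ℝ)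
    (hpos : ∀ f, 0 ≤ ⟪B f, f⟫_ℝ) (f : H) :
    ‖B f‖ ^ 2 ≤ ‖B‖ * ⟪B f, f⟫_ℝ := by
  have h := form_cs B hsym hpos f (B f)
  rw [real_inner_self_eq_norm_sq] at h
  have h2 : ⟪B (B f), B f⟫_ℝ ≤ ‖B‖ * ‖B f‖ ^ 2 := by
    calc _ ≤ ‖B (B f)‖ * ‖B f‖ := real_inner_le_norm _ _
      _ ≤ (‖B‖ * ‖B f‖) * ‖B f‖ := by gcongr; exact B.le_opNorm _
      _ = _ := by ring
  have h3 := mul_le_mul_of_nonneg_left h2 (hpos f)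
  rcases eq_or_lt_of_le (sq_nonneg ‖B f‖) with h0 | h0
  · rw [← h0]; exact mul_nonneg (norm_nonneg _) (hpos f)
  · refine le_of_mul_le_mul_right ?_ h0
    nlinarith

lemma unit_bdd (C : H →L[ℝ] H) (hC : IsUnit C) : ∃ K > 0, ∀ f, ‖f‖ ≤ K * ‖C f‖ := by
  obtain ⟨u, rfl⟩ := hC
  refine ⟨‖(↑u⁻¹ : H →L[ℝ] H)‖ + 1, by positivity, fun f => ?_⟩
  have h : (↑u⁻¹ : H →L[ℝ] H) ((u : H →L[ℝ] H) f) = f := by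
    rw [← mul_apply_eq_comp, Units.inv_mul]; rfl
  calc ‖f‖ = ‖(↑u⁻¹ : H →L[ℝ] H) ((u : H →L[ℝ] H) f)‖ := by rw [h]
    _ ≤ ‖(↑u⁻¹ : H →L[ℝ] H)‖ * ‖(u : H →L[ℝ] H) f‖ := ContinuousLinearMap.le_opNorm _ _
    _ ≤ _ := by gcongr; linarith

lemma form_nonneg_of_units (B : H →L[ℝ] H) (hsym : ∀ f g, ⟪B f, g⟫_ℝ = ⟪f, B g⟫_ℝ)
    (k : ℝ) (hk0 : 0 ≤ k) (hk : ∀ f, -k * ‖f‖ ^ 2 ≤ ⟪B f, f⟫_ℝ)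
    (hu : ∀ t, 0 < t → t ≤ k → IsUnit (B + t • (1 : H →L[ℝ] H))) (f : H) :
    0 ≤ ⟪B f, f⟫_ℝ := by
  set S : Set ℝ := {t | 0 ≤ t ∧ ∀ f, -t * ‖f‖ ^ 2 ≤ ⟪B f, f⟫_ℝ} with hS
  have hkS : k ∈ S := ⟨hk0, hk⟩
  have hbdd : BddBelow S := ⟨0, fun t ht => ht.1⟩
  have hclosed : IsClosed S := by
    have : S = {t | 0 ≤ t} ∩ ⋂ f : H, {t | -t * ‖f‖ ^ 2 ≤ ⟪B f, f⟫_ℝ} := by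
      ext t; simp [hS]
    rw [this]
    refine (isClosed_le (by fun_prop) (by fun_prop)).inter (isClosed_iInter fun f => ?_)
    exact isClosed_le (by fun_prop) (by fun_prop)
  have hmem := hclosed.csInf_mem ⟨k, hkS⟩ hbdd
  set t := sInf S with ht
  rcases eq_or_lt_of_le hmem.1 with h0 | h0
  · have := hmem.2 f
    rw [← h0] at this; simpa using this
  exfalso
  have htk : t ≤ k := csInf_le hbdd hkS
  set C := B + t • (1 : H →L[ℝ] H) with hC
  have hCf : ∀ f, ⟪C f, f⟫_ℝ = ⟪B f, f⟫_ℝ + t * ‖f‖ ^ 2 := by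
    intro f
    simp [hC, inner_add_left, inner_smul_left]
  have hCpos : ∀ f, 0 ≤ ⟪C f, f⟫_ℝ := by
    intro f; rw [hCf]; linarith [hmem.2 f]
  have hCsym : ∀ f g, ⟪C f, g⟫_ℝ = ⟪f, C g⟫_ℝ := by
    intro f g
    simp [hC, inner_add_left, inner_smul_left, inner_add_right, inner_smul_right, hsym]
  obtain ⟨K, hK, hb⟩ := unit_bdd C (hu t h0 htk)
  have hN : 0 < K ^ 2 * (‖C‖ + 1) := by positivity
  set d := min t (1 / (K ^ 2 * (‖C‖ + 1))) with hd
  have hd0 : 0 < d := lt_min h0 (by positivity)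
  have hmem' : t - d ∈ S := by
    refine ⟨by linarith [min_le_left t (1 / (K ^ 2 * (‖C‖ + 1)))], fun f => ?_⟩
    have h1 := form_sq_le C hCsym hCpos f
    have h2 : ‖f‖ ^ 2 ≤ (K * ‖C f‖) ^ 2 := by gcongr; exact hb f
    have h3 : ‖f‖ ^ 2 ≤ K ^ 2 * (‖C‖ + 1) * ⟪C f, f⟫_ℝ := by
      calc _ ≤ K ^ 2 * ‖C f‖ ^ 2 := by rw [← mul_pow]; exact h2
        _ ≤ K ^ 2 * ((‖C‖ + 1) * ⟪C f, f⟫_ℝ) := by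
          gcongr; nlinarith [hCpos f]
        _ = _ := by ring
    have h4 : d * ‖f‖ ^ 2 ≤ ⟪C f, f⟫_ℝ := by
      calc _ ≤ 1 / (K ^ 2 * (‖C‖ + 1)) * ‖f‖ ^ 2 := by gcongr; exact min_le_right _ _
        _ ≤ 1 / (K ^ 2 * (‖C‖ + 1)) * (K ^ 2 * (‖C‖ + 1) * ⟪C f, f⟫_ℝ) := by gcongr
        _ = _ := by field_simp
    rw [hCf] at h4; linarith
  linarith [csInf_le hbdd hmem']

lemma gap [CompleteSpace H] (A : H →L[ℝ] H) (hsym : ∀ f g, ⟪A f, g⟫_ℝ = ⟪f, A g⟫_ℝ)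
    (hpos : ∀ f, 0 ≤ ⟪A f, f⟫_ℝ) (a : ℝ) (ha : 0 < a)
    (hu : ∀ s, 0 < s → s < a → IsUnit (A - s • (1 : H →L[ℝ] H)))
    (g : H) (hg : ∀ h, A h = 0 → ⟪h, g⟫_ℝ = 0) : a * ‖g‖ ^ 2 ≤ ⟪A g, g⟫_ℝ := by
  have key : ∀ f, a * ⟪A f, f⟫_ℝ ≤ ‖A f‖ ^ 2 := by
    intro f
    have hB : ∀ f, ⟪(A * A - a • A) f, f⟫_ℝ = ‖A f‖ ^ 2 - a * ⟪A f, f⟫_ℝ := by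
      intro f
      simp [inner_sub_left, inner_smul_left, hsym (A f) f]
    have := form_nonneg_of_units (A * A - a • A) ?_ (a ^ 2 / 4) (by positivity) ?_ ?_ f
    · rw [hB] at this; linarith
    · intro f g
      simp [inner_sub_left, inner_smul_left, inner_sub_right, inner_smul_right, hsym]
    · intro f
      rw [hB]
      have h1 : ⟪A f, f⟫_ℝ ≤ ‖A f‖ * ‖f‖ := real_inner_le_norm _ _
      nlinarith [sq_nonneg (‖A f‖ - a / 2 * ‖f‖)]
    · intro t ht htk
      have hr : 0 ≤ a ^ 2 - 4 * t := by linarith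
      have hs0 := Real.sqrt_nonneg (a ^ 2 - 4 * t)
      have hs := Real.sq_sqrt hr
      set s := √(a ^ 2 - 4 * t)
      have hsa : s < a := by nlinarith
      have := (hu ((a + s) / 2) (by linarith) (by linarith)).mul
        (hu ((a - s) / 2) (by linarith) (by linarith))
      convert this using 1
      have ht' : t = ((a + s) / 2) * ((a - s) / 2) := by linarith
      rw [ht']
      ext f
      simp only [_root_.add_apply, _root_.sub_apply,
        mul_apply_eq_comp, _root_.smul_apply,
        one_apply_eq_self, map_sub, map_smul]
      module
  have hrange : ∀ f, a * ‖A f‖ ^ 2 ≤ ⟪A (A f), A f⟫_ℝ := by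
    intro f
    have h := form_cs A hsym hpos f (A f)
    rw [real_inner_self_eq_norm_sq] at h
    have h1 := mul_le_mul_of_nonneg_right (key f) (hpos (A f))
    rcases eq_or_lt_of_le (sq_nonneg ‖A f‖) with h0 | h0
    · rw [← h0]; simpa using hpos (A f)
    · refine le_of_mul_le_mul_right ?_ h0
      nlinarith
  have hadj : ContinuousLinearMap.adjoint A = A := by
    symm; rw [ContinuousLinearMap.eq_adjoint_iff]; exact hsym
  have hgm : g ∈ A.rangeᗮᗮ := by
    rw [ContinuousLinearMap.orthogonal_range, hadj, Submodule.mem_orthogonal]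
    intro h hh
    exact hg h (by simpa using hh)
  rw [Submodule.orthogonal_orthogonal_eq_closure] at hgm
  have hcl : IsClosed {g : H | a * ‖g‖ ^ 2 ≤ ⟪A g, g⟫_ℝ} :=
    isClosed_le (by fun_prop) (by fun_prop)
  have hsub : ((A.range : Submodule ℝ H) : Set H) ⊆ {g : H | a * ‖g‖ ^ 2 ≤ ⟪A g, g⟫_ℝ} := by
    rintro _ ⟨f, rfl⟩
    exact hrange f
  exact closure_minimal hsub hcl hgm

end abstractPart

lemma kernelPow_nonneg (p : ℕ → ℕ → ℝ) (hp : ∀ x y, 0 ≤ p x y) (n x y : ℕ) :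
    0 ≤ kernelPow p n x y := by
  induction n generalizing y with
  | zero => simp only [kernelPow]; split_ifs <;> norm_num
  | succ n ih => exact tsum_nonneg fun z => mul_nonneg (ih z) (hp z y)

lemma const_of_irr (p : ℕ → ℕ → ℝ) (hp : ∀ x y, 0 ≤ p x y) (f : ℕ → ℝ)
    (hf : ∀ x y, 0 < p x y → f x = f y) (n x y : ℕ) (h : 0 < kernelPow p n x y) :
    f x = f y := by
  induction n generalizing y with
  | zero =>
    simp only [kernelPow] at h
    split_ifs at h with hxy
    · rw [hxy]
    · exact absurd h (lt_irrefl _)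
  | succ n ih =>
    by_contra hne
    refine absurd h (not_lt.2 (tsum_nonpos fun z => ?_))
    by_contra! hz
    have h1 : 0 < kernelPow p n x z := by
      refine lt_of_le_of_ne (kernelPow_nonneg p hp n x z) fun h0 => ?_
      rw [← h0] at hz; simp at hz
    have h2 : 0 < p z y := by
      refine lt_of_le_of_ne (hp z y) fun h0 => ?_
      rw [← h0] at hz; simp at hz
    exact hne ((ih z h1).trans (hf z y h2))

lemma HasSum.congr_fun' {ι : Type*} {u v : ι → ℝ} {a : ℝ} (h : HasSum u a)
    (huv : ∀ i, u i = v i) : HasSum v a := by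
  have : u = v := funext huv
  rwa [← this]

section dirichlet
variable (p : ℕ → ℕ → ℝ) (π : ℕ → ℝ)

lemma sum1 (hp : ∀ x y, 0 ≤ p x y) (hrow : ∀ x, HasSum (p x) 1) (hπ : ∀ x, 0 ≤ π x)
    (f : ℕ → ℝ) (hf : Summable fun x => π x * f x ^ 2) :
    HasSum (fun q : ℕ × ℕ => π q.1 * p q.1 q.2 * f q.1 ^ 2) (∑' x, π x * f x ^ 2) := by
  have hrow' : ∀ x, HasSum (fun y => π x * p x y * f x ^ 2) (π x * f x ^ 2) := by
    intro x
    have := (hrow x).mul_left (π x * f x ^ 2)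
    rw [mul_one] at this
    exact this.congr_fun' fun y => by ring
  have hs : Summable (fun q : ℕ × ℕ => π q.1 * p q.1 q.2 * f q.1 ^ 2) := by
    rw [summable_prod_of_nonneg]
    · refine ⟨fun x => (hrow' x).summable, ?_⟩
      simpa only [(hrow' _).tsum_eq] using hf
    · intro q
      exact mul_nonneg (mul_nonneg (hπ _) (hp _ _)) (sq_nonneg _)
  have := hs.hasSum
  rw [hs.tsum_prod] at this
  simpa only [(hrow' _).tsum_eq] using this

lemma sum2 (hp : ∀ x y, 0 ≤ p x y) (hrow : ∀ x, HasSum (p x) 1) (hπ : ∀ x, 0 ≤ π x)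
    (hrev : ∀ x y, p x y * π x = p y x * π y)
    (f : ℕ → ℝ) (hf : Summable fun x => π x * f x ^ 2) :
    HasSum (fun q : ℕ × ℕ => π q.1 * p q.1 q.2 * f q.2 ^ 2) (∑' x, π x * f x ^ 2) := by
  have h := (Equiv.prodComm ℕ ℕ).hasSum_iff.2 (sum1 p π hp hrow hπ f hf)
  convert h using 2 with q
  have := hrev q.1 q.2
  simp only [Function.comp, Equiv.prodComm_apply, Prod.fst_swap, Prod.snd_swap]
  rw [mul_comm (π q.1), this]; ring

lemma sum3 (hp : ∀ x y, 0 ≤ p x y) (hrow : ∀ x, HasSum (p x) 1) (hπ : ∀ x, 0 ≤ π x)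
    (hrev : ∀ x y, p x y * π x = p y x * π y)
    (f g : ℕ → ℝ) (hf : Summable fun x => π x * f x ^ 2)
    (hg : Summable fun x => π x * g x ^ 2) :
    HasSum (fun q : ℕ × ℕ => π q.1 * p q.1 q.2 * (f q.2 * g q.1))
      (∑' x, π x * ((∑' y, p x y * f y) * g x)) := by
  have hs : Summable (fun q : ℕ × ℕ => π q.1 * p q.1 q.2 * (f q.2 * g q.1)) := by
    refine Summable.of_norm_bounded ((sum2 p π hp hrow hπ hrev f hf).summable.add
      (sum1 p π hp hrow hπ g hg).summable) fun q => ?_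
    have h0 := mul_nonneg (hπ q.1) (hp q.1 q.2)
    rw [Real.norm_eq_abs, abs_mul, abs_of_nonneg h0, ← mul_add]
    refine mul_le_mul_of_nonneg_left ?_ h0
    rw [abs_le]
    constructor <;> nlinarith [sq_nonneg (f q.2 + g q.1), sq_nonneg (f q.2 - g q.1)]
  have := hs.hasSum
  rw [hs.tsum_prod] at this
  have he : (∑' x, π x * ((∑' y, p x y * f y) * g x)) =
      ∑' (x : ℕ) (y : ℕ), π x * p x y * (f y * g x) := by
    refine tsum_congr fun x => ?_
    rw [mul_comm (tsum _), ← mul_assoc, ← tsum_mul_left]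
    exact tsum_congr fun y => by ring
  rw [he]; exact this

end dirichlet

/-- For an irreducible Markov transition matrix `p` on `ℕ`, reversible with
respect to a strictly positive probability measure `π`, with induced transition operator `P`
on `L²(π)`, if `λ̂₀⁽ˣ⁾ := sup {⟨Pf,f⟩_π : f(x) = 0, ‖f‖_π = 1} = 1` for some `x`, then `1` is
not an isolated point of the spectrum of `P`. -/
theorem stmt1 (p : ℕ → ℕ → ℝ) (π : ℕ → ℝ)
    (hp01 : ∀ x y, p x y ∈ Set.Icc (0 : ℝ) 1)
    (hrow : ∀ x, ∑' y, p x y = 1)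
    (hirr : ∀ x y, ∃ n ≥ 1, 0 < kernelPow p n x y)
    (hπpos : ∀ x, 0 < π x) (hπ1 : ∑' x, π x = 1)
    (hrev : ∀ x y, p x y * π x = p y x * π y)
    (μ : MeasureTheory.Measure ℕ)
    (hμ : μ = MeasureTheory.Measure.count.withDensity fun x => ENNReal.ofReal (π x))
    (P : MeasureTheory.Lp ℝ 2 μ →L[ℝ] MeasureTheory.Lp ℝ 2 μ)
    (hP : ∀ f : MeasureTheory.Lp ℝ 2 μ, ∀ x : ℕ, P f x = ∑' y, p x y * f y)
    (x : ℕ)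
    (hx : sSup {r : ℝ | ∃ f : MeasureTheory.Lp ℝ 2 μ,
        f x = 0 ∧ ‖f‖ = 1 ∧ r = ⟪P f, f⟫_ℝ} = 1) :
    (1 : ℝ) ∈ closure (spectrum ℝ P \ {1}) := by
  have hp : ∀ x y, 0 ≤ p x y := fun x y => (hp01 x y).1
  have hπ : ∀ x, 0 ≤ π x := fun x => (hπpos x).le
  have summ_of : ∀ u : ℕ → ℝ, ∑' y, u y = 1 → HasSum u 1 := by
    intro u hu
    have : Summable u := by
      by_contra h
      rw [tsum_eq_zero_of_not_summable h] at hu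
      exact zero_ne_one hu
    rw [← hu]; exact this.hasSum
  have hrow' : ∀ x, HasSum (p x) 1 := fun x => summ_of _ (hrow x)
  have hπ1' : HasSum π 1 := summ_of _ hπ1
  have hsing : ∀ x, μ {x} = ENNReal.ofReal (π x) := by
    intro x
    rw [hμ, MeasureTheory.withDensity_apply _ (MeasurableSet.singleton x)]
    simp
  have hreal : ∀ x, μ.real {x} = π x := by
    intro x
    rw [MeasureTheory.measureReal_def, hsing, ENNReal.toReal_ofReal (hπ x)]
  have hae : ∀ Q : ℕ → Prop, (∀ᵐ x ∂μ, Q x) → ∀ x, Q x := by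
    intro Q hQ x
    by_contra hx
    have h1 : μ {x} ≤ μ {x | ¬ Q x} := MeasureTheory.measure_mono (by simpa using hx)
    rw [MeasureTheory.ae_iff.1 hQ, hsing] at h1
    have := ENNReal.ofReal_pos.2 (hπpos x)
    exact absurd h1 (not_le.2 this)
  have hint : ∀ u : ℕ → ℝ, MeasureTheory.Integrable u μ → HasSum (fun x => π x * u x) (∫ x, u x ∂μ) := by
    intro u hu
    rw [MeasureTheory.integral_countable hu]
    simp only [hreal, smul_eq_mul]
    refine Summable.hasSum ?_
    rw [hμ, MeasureTheory.integrable_withDensity_iff_integrable_smul' (by fun_prop)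
      (by simp), MeasureTheory.integrable_count_iff] at hu
    refine Summable.of_norm ?_
    simpa only [ENNReal.toReal_ofReal (hπ _), smul_eq_mul] using hu
  have hprob : MeasureTheory.IsProbabilityMeasure μ := by
    constructor
    rw [hμ, MeasureTheory.withDensity_apply _ MeasurableSet.univ]
    simp only [MeasureTheory.Measure.restrict_univ, MeasureTheory.lintegral_count]
    rw [← ENNReal.ofReal_tsum_of_nonneg hπ hπ1'.summable, hπ1, ENNReal.ofReal_one]
  have hinner : ∀ f g : MeasureTheory.Lp ℝ 2 μ,
      HasSum (fun x => π x * (f x * g x)) ⟪f, g⟫_ℝ := by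
    intro f g
    have := hint _ (MeasureTheory.L2.integrable_inner (𝕜 := ℝ) f g)
    rw [MeasureTheory.L2.inner_def]
    convert this using 3
    simp [mul_comm]
  have hsq : ∀ f : MeasureTheory.Lp ℝ 2 μ, HasSum (fun x => π x * f x ^ 2) (‖f‖ ^ 2) := by
    intro f
    have := hinner f f
    rw [real_inner_self_eq_norm_sq] at this
    simpa only [sq] using this
  have hPin : ∀ f g : MeasureTheory.Lp ℝ 2 μ,
      HasSum (fun q : ℕ × ℕ => π q.1 * p q.1 q.2 * (f q.2 * g q.1)) ⟪P f, g⟫_ℝ := by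
    intro f g
    have := sum3 p π hp hrow' hπ hrev f g (hsq f).summable (hsq g).summable
    rw [← (hinner (P f) g).tsum_eq]
    simpa only [hP] using this
  have hPsym : ∀ f g : MeasureTheory.Lp ℝ 2 μ, ⟪P f, g⟫_ℝ = ⟪f, P g⟫_ℝ := by
    intro f g
    rw [real_inner_comm (P g) f]
    refine (hPin f g).unique ?_
    have h := (Equiv.prodComm ℕ ℕ).hasSum_iff.2 (hPin g f)
    convert h using 2 with q
    have := hrev q.1 q.2
    simp only [Function.comp, Equiv.prodComm_apply, Prod.fst_swap, Prod.snd_swap]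
    rw [mul_comm (π q.1), this]; ring
  set A : MeasureTheory.Lp ℝ 2 μ →L[ℝ] MeasureTheory.Lp ℝ 2 μ := 1 - P with hA
  have hAin : ∀ f, ⟪A f, f⟫_ℝ = ‖f‖ ^ 2 - ⟪P f, f⟫_ℝ := by
    intro f
    simp [hA, inner_sub_left]
  have hAsym : ∀ f g, ⟪A f, g⟫_ℝ = ⟪f, A g⟫_ℝ := by
    intro f g
    simp [hA, inner_sub_left, inner_sub_right, hPsym]
  have hdir : ∀ f : MeasureTheory.Lp ℝ 2 μ,
      HasSum (fun q : ℕ × ℕ => π q.1 * p q.1 q.2 * (f q.1 - f q.2) ^ 2) (2 * ⟪A f, f⟫_ℝ) := by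
    intro f
    have h1 := sum1 p π hp hrow' hπ f (hsq f).summable
    have h2 := sum2 p π hp hrow' hπ hrev f (hsq f).summable
    rw [(hsq f).tsum_eq] at h1 h2
    have h3 := (h1.add h2).sub ((hPin f f).mul_left 2)
    rw [hAin]
    rw [show 2 * (‖f‖ ^ 2 - ⟪P f, f⟫_ℝ) = ‖f‖ ^ 2 + ‖f‖ ^ 2 - 2 * ⟪P f, f⟫_ℝ by
      rw [mul_sub, two_mul (‖f‖ ^ 2)]]
    exact h3.congr_fun' fun q => by ring
  have hdnn : ∀ (f : MeasureTheory.Lp ℝ 2 μ) (q : ℕ × ℕ),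
      0 ≤ π q.1 * p q.1 q.2 * (f q.1 - f q.2) ^ 2 := fun f q =>
    mul_nonneg (mul_nonneg (hπ _) (hp _ _)) (sq_nonneg _)
  have hApos : ∀ f, 0 ≤ ⟪A f, f⟫_ℝ := by
    intro f
    have := (hdir f).nonneg (hdnn f)
    linarith
  have hker : ∀ f : MeasureTheory.Lp ℝ 2 μ, A f = 0 → ∀ y, f y = f 0 := by
    intro f hf y
    have h := hdir f
    rw [hf, inner_zero_left, mul_zero, hasSum_zero_iff_of_nonneg (hdnn f)] at h
    obtain ⟨n, -, hn⟩ := hirr y 0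
    refine const_of_irr p hp f (fun z w hzw => ?_) n y 0 hn
    have h' := congrFun h (z, w)
    have h0 : π z * p z w ≠ 0 := (mul_pos (hπpos z) hzw).ne'
    simp only [Pi.zero_apply, mul_eq_zero (a := π z * p z w), h0, false_or] at h'
    exact sub_eq_zero.1 (pow_eq_zero_iff (two_ne_zero)|>.1 h')
  set e : MeasureTheory.Lp ℝ 2 μ :=
    (MeasureTheory.memLp_const (μ := μ) (p := 2) (1 : ℝ)).toLp _ with he
  have he1 : ∀ y, e y = 1 := hae _ (MeasureTheory.MemLp.coeFn_toLp _)
  have hext : ∀ f g : MeasureTheory.Lp ℝ 2 μ, (∀ y, f y = g y) → f = g := fun f g h =>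
    MeasureTheory.Lp.ext (Filter.Eventually.of_forall h)
  have hPe : P e = e := by
    refine hext _ _ fun y => ?_
    rw [hP]; simp only [he1, mul_one, hrow]
  have hAe : A e = 0 := by simp [hA, hPe]
  have hen : ‖e‖ ^ 2 = 1 := by
    have := hsq e
    simp only [he1, one_pow, mul_one] at this
    exact this.unique hπ1'
  have hsmul : ∀ (c : ℝ) (f : MeasureTheory.Lp ℝ 2 μ) y, (c • f) y = c * f y := by
    intro c f
    exact hae _ (MeasureTheory.Lp.coeFn_smul c f)
  have hsub : ∀ (f g : MeasureTheory.Lp ℝ 2 μ) y, (f - g) y = f y - g y := by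
    intro f g
    exact hae _ (MeasureTheory.Lp.coeFn_sub f g)
  by_contra hcl
  rw [Metric.mem_closure_iff] at hcl
  push Not at hcl
  obtain ⟨a, ha, hcl⟩ := hcl
  have hu : ∀ s, 0 < s → s < a →
      IsUnit (A - s • (1 : MeasureTheory.Lp ℝ 2 μ →L[ℝ] MeasureTheory.Lp ℝ 2 μ)) := by
    intro s hs hsa
    by_contra hn
    have hmem : (1 - s) ∈ spectrum ℝ P := by
      rw [spectrum.mem_iff]
      convert hn using 2
      rw [Algebra.algebraMap_eq_smul_one, hA, sub_smul, one_smul]; abel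
    have := hcl (1 - s) ⟨hmem, by simp; linarith⟩
    rw [Real.dist_eq, sub_sub_cancel, abs_of_pos hs] at this
    linarith
  have hgap := gap A hAsym hApos a ha hu
  have hne : {r : ℝ | ∃ f : MeasureTheory.Lp ℝ 2 μ,
        f x = 0 ∧ ‖f‖ = 1 ∧ r = ⟪P f, f⟫_ℝ}.Nonempty := by
    by_contra h
    rw [Set.not_nonempty_iff_eq_empty] at h
    rw [h, Real.sSup_empty] at hx
    exact zero_ne_one hx
  have hd : 0 < a * π x / (1 + π x) := by
    have := hπpos x
    positivity
  obtain ⟨r, ⟨f, hfx, hfn, rfl⟩, hr⟩ := exists_lt_of_lt_csSup hne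
    (b := 1 - a * π x / (1 + π x)) (by rw [hx]; linarith)
  set c := ⟪e, f⟫_ℝ with hc
  have hce : ⟪e, f - c • e⟫_ℝ = 0 := by
    rw [inner_sub_right, inner_smul_right, real_inner_self_eq_norm_sq, hen]; ring
  have hg := hgap (f - c • e) (by
    intro h hh
    have : h = (h 0) • e := hext _ _ fun y => by rw [hsmul, he1, mul_one, hker h hh]
    rw [this, inner_smul_left, hce, mul_zero])
  have hAg : ⟪A (f - c • e), f - c • e⟫_ℝ = 1 - ⟪P f, f⟫_ℝ := by
    rw [map_sub, map_smul, hAe, smul_zero, sub_zero, inner_sub_right, inner_smul_right,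
      hAsym f e, hAe, inner_zero_right, mul_zero, sub_zero, hAin, hfn, one_pow]
  have hgn : ‖f - c • e‖ ^ 2 = 1 - c ^ 2 := by
    rw [← real_inner_self_eq_norm_sq, inner_sub_left, inner_smul_left, hce, inner_sub_right,
      inner_smul_right, real_inner_self_eq_norm_sq, hfn, real_inner_comm, ← hc]
    simp; ring
  have hgx : π x * c ^ 2 ≤ ‖f - c • e‖ ^ 2 := by
    have h := le_hasSum (hsq (f - c • e)) x fun y _ => mul_nonneg (hπ y) (sq_nonneg _)
    rw [hsub, hsmul, he1, hfx] at h
    simpa using h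
  rw [hAg] at hg
  have h1 : a * ‖f - c • e‖ ^ 2 < a * π x / (1 + π x) := by linarith
  have hpx := hπpos x
  rw [lt_div_iff₀ (by positivity)] at h1
  have h2 : ‖f - c • e‖ ^ 2 * (1 + π x) < π x := by
    refine lt_of_mul_lt_mul_left ?_ ha.le
    linarith
  rw [hgn] at h2 hgx
  nlinarith
end

section
/- Let α ∈ (0,1) and let (c_x)_{x≥1} be a sequence with 0 < c_x < 1/2 and 0 < liminf_{x→∞} c_x x^{α} ≤ limsup_{x→∞} c_x x^{α} < ∞. Set p_x = 1/2 − c_x, q_x = 1/2 + c_x, and π̃(0) = 1, π̃(x) = ∏_{k=1}^{x} p_{k−1}/q_k for x ≥ 1 (with p_0 = 1). Then ∑_{x=0}^{∞} π̃(x) < ∞, i.e. the birth and death chain with these transition probabilities is positive recurrent. -/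
open Filter

/-- If `α ∈ (0,1)`, `0 < cₓ < 1/2`,
`0 < liminf cₓ xᵅ ≤ limsup cₓ xᵅ < ∞`, `pₓ = 1/2 - cₓ`, `qₓ = 1/2 + cₓ` (with `p₀ = 1`), and
`π̃(0) = 1`, `π̃(x) = ∏_{k=1}^x p_{k-1}/q_k`, then `∑ₓ π̃(x) < ∞`, i.e. the birth and death
chain with these transition probabilities is positive recurrent. -/
theorem stmt8 (α : ℝ) (hα0 : 0 < α) (hα1 : α < 1) (c : ℕ → ℝ)
    (hc : ∀ x ≥ 1, 0 < c x ∧ c x < 1 / 2)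
    (hliminf : ∃ c₀ > 0, ∀ᶠ x : ℕ in atTop, c₀ ≤ c x * (x : ℝ) ^ α)
    (hlimsup : ∃ C : ℝ, ∀ᶠ x : ℕ in atTop, c x * (x : ℝ) ^ α ≤ C)
    (p q : ℕ → ℝ) (hp0 : p 0 = 1)
    (hp : ∀ x ≥ 1, p x = 1 / 2 - c x)
    (hq : ∀ x ≥ 1, q x = 1 / 2 + c x)
    (πt : ℕ → ℝ)
    (hπt : ∀ x, πt x = ∏ k ∈ Finset.Icc 1 x, p (k - 1) / q k) :
    Summable πt := by
  obtain ⟨c₀, hc₀, hl⟩ := hliminf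
  have ht : Tendsto (fun x : ℕ => (x : ℝ) ^ (1 - α)) atTop atTop :=
    (tendsto_rpow_atTop (by linarith)).comp tendsto_natCast_atTop_atTop
  obtain ⟨N, hN⟩ := eventually_atTop.1
    ((hl.and (ht.eventually_ge_atTop (1 / c₀))).and (eventually_ge_atTop 1))
  have hcx : ∀ x ≥ N, 1 ≤ c x * x := by
    intro x hx
    obtain ⟨⟨h1, h2⟩, h3⟩ := hN x hx
    have hx0 : (0 : ℝ) < x := by exact_mod_cast h3
    have e : (x : ℝ) = (x : ℝ) ^ α * (x : ℝ) ^ (1 - α) := by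
      rw [← Real.rpow_add hx0]; simp
    have : c x * x = (c x * (x : ℝ) ^ α) * (x : ℝ) ^ (1 - α) := by
      rw [mul_assoc, ← e]
    rw [this]
    calc (1 : ℝ) = c₀ * (1 / c₀) := by field_simp
      _ ≤ _ := mul_le_mul h1 h2 (by positivity) (by linarith)
  have hN1 : 1 ≤ N := (hN N le_rfl).2
  have hqpos : ∀ x ≥ 1, 0 < q x := fun x hx => by
    rw [hq x hx]; linarith [(hc x hx).1]
  have hppos : ∀ x, 0 < p x := fun x => by
    rcases Nat.eq_zero_or_pos x with h | h
    · rw [h, hp0]; norm_num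
    · rw [hp x h]; linarith [(hc x h).2]
  have hpos : ∀ x, 0 < πt x := fun x => by
    rw [hπt]
    refine Finset.prod_pos fun k hk => div_pos (hppos _) (hqpos _ (Finset.mem_Icc.1 hk).1)
  have hrec : ∀ x, πt (x + 1) * q (x + 1) = πt x * p x := fun x => by
    have := hqpos (x + 1) (by omega)
    rw [hπt, hπt, Finset.prod_Icc_succ_top (by omega)]
    simp only [Nat.add_sub_cancel]
    field_simp
  have hstep : ∀ x ≥ N, πt x * q x ≤ x * (πt x * q x) - (x + 1) * (πt (x + 1) * q (x + 1)) := by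
    intro x hx
    have hx1 : 1 ≤ x := hN1.trans hx
    have h1 := hcx x hx
    have hx0 : (1 : ℝ) ≤ x := by exact_mod_cast hx1
    rw [hrec, hp x hx1, hq x hx1]
    have h2 : 0 ≤ x * (1 / 2 + c x) - (x + 1) * (1 / 2 - c x) - (1 / 2 + c x) := by
      nlinarith [hc x hx1]
    nlinarith [mul_nonneg (hpos x).le h2]
  have hsum : Summable (fun n => πt (n + N) * q (n + N)) := by
    refine summable_of_sum_range_le (c := N * (πt N * q N))
      (fun n => (mul_pos (hpos _) (hqpos _ (by omega))).le) ?_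
    have key : ∀ n : ℕ, ∑ i ∈ Finset.range n, πt (i + N) * q (i + N) ≤
        N * (πt N * q N) - ((n + N : ℕ) : ℝ) * (πt (n + N) * q (n + N)) := by
      intro n
      induction n with
      | zero => simp
      | succ n ih =>
        rw [Finset.sum_range_succ]
        have := hstep (n + N) (by omega)
        have e : n + 1 + N = n + N + 1 := by omega
        rw [e, Nat.cast_succ]
        linarith
    intro n
    have h0 : 0 ≤ ((n + N : ℕ) : ℝ) * (πt (n + N) * q (n + N)) :=
      mul_nonneg (Nat.cast_nonneg _) (mul_pos (hpos _) (hqpos _ (by omega))).le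
    linarith [key n]
  rw [← summable_nat_add_iff N]
  refine Summable.of_nonneg_of_le (fun n => (hpos _).le) (fun n => ?_) (hsum.mul_left 2)
  have h1 : 1 ≤ n + N := by omega
  rw [hq _ h1]
  nlinarith [mul_pos (hpos (n + N)) (hc _ h1).1]
end

section
/- Let α ∈ (0,1) and let (c_x)_{x≥1} satisfy 0 < c_x < 1/2 and 0 < liminf_{x→∞} c_x x^{α} ≤ limsup_{x→∞} c_x x^{α} < ∞. Let {X_n} be the birth and death chain on ℤ₊ with p(0,1) = 1, p(x,x+1) = p_x = 1/2 − c_x, p(x,x−1) = q_x = 1/2 + c_x for x ≥ 1, and let π be its (unique, strictly positive) invariant probability measure π(x) = Z^{−1} ∏_{k=1}^{x} p_{k−1}/q_k. Then the chain does not have the spectral gap property: λ₁ := sup{⟨Pf,f⟩_π : f ∈ L²(π), ∑_x f(x)π(x) = 0, ||f||_π = 1} = 1; moreover 1 is not an isolated point of the spectrum of the transition operator P on L²(π). -/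
open Filter
open scoped InnerProductSpace ENNReal

section abstractHilbert
variable {H : Type*} [NormedAddCommGroup H] [InnerProductSpace ℝ H]

lemma aux_cs (C : H →L[ℝ] H) (hs : ∀ f g, ⟪C f, g⟫_ℝ = ⟪f, C g⟫_ℝ)
    (hpos : ∀ f, 0 ≤ ⟪C f, f⟫_ℝ) (f g : H) :
    ⟪C f, g⟫_ℝ ^ 2 ≤ ⟪C f, f⟫_ℝ * ⟪C g, g⟫_ℝ := by
  have h : ∀ t : ℝ, 0 ≤ ⟪C g, g⟫_ℝ * (t * t) + (2 * ⟪C f, g⟫_ℝ) * t + ⟪C f, f⟫_ℝ := by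
    intro t
    have h1 := hpos (f + t • g)
    have h2 : ⟪C g, f⟫_ℝ = ⟪C f, g⟫_ℝ := by rw [hs, real_inner_comm]
    simp only [map_add, map_smul, inner_add_left, inner_add_right, real_inner_smul_left,
      real_inner_smul_right, h2] at h1
    linarith
  have := discrim_le_zero h
  unfold discrim at this
  nlinarith

lemma aux_sq (C : H →L[ℝ] H) (hs : ∀ f g, ⟪C f, g⟫_ℝ = ⟪f, C g⟫_ℝ)
    (hpos : ∀ f, 0 ≤ ⟪C f, f⟫_ℝ) (f : H) :
    ‖C f‖ ^ 2 ≤ ‖C‖ * ⟪C f, f⟫_ℝ := by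
  have h := aux_cs C hs hpos f (C f)
  rw [real_inner_self_eq_norm_sq] at h
  have h2 : ⟪C (C f), C f⟫_ℝ ≤ ‖C‖ * ‖C f‖ ^ 2 := by
    calc _ ≤ ‖C (C f)‖ * ‖C f‖ := real_inner_le_norm _ _
      _ ≤ (‖C‖ * ‖C f‖) * ‖C f‖ := by gcongr; exact C.le_opNorm _
      _ = _ := by ring
  rcases eq_or_ne (C f) 0 with h0 | h0
  · simp [h0]
  have hp : 0 < ‖C f‖ ^ 2 := by positivity
  have h3 := mul_le_mul_of_nonneg_left h2 (hpos f)
  have : ‖C f‖ ^ 2 * ‖C f‖ ^ 2 ≤ (‖C‖ * ⟪C f, f⟫_ℝ) * ‖C f‖ ^ 2 := by nlinarith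
  exact le_of_mul_le_mul_right this hp

lemma aux_unit (C : H →L[ℝ] H) (hC : IsUnit C) : ∃ κ > 0, ∀ f, κ * ‖f‖ ^ 2 ≤ ‖C f‖ ^ 2 := by
  obtain ⟨u, rfl⟩ := hC
  refine ⟨((‖(↑u⁻¹ : H →L[ℝ] H)‖ + 1) ^ 2)⁻¹, by positivity, fun f => ?_⟩
  have h1 : (↑u⁻¹ : H →L[ℝ] H) ((↑u : H →L[ℝ] H) f) = f := by
    rw [← mul_apply_eq_comp, Units.inv_mul]; rfl
  have h2 : ‖f‖ ≤ (‖(↑u⁻¹ : H →L[ℝ] H)‖ + 1) * ‖(↑u : H →L[ℝ] H) f‖ := by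
    calc ‖f‖ = ‖(↑u⁻¹ : H →L[ℝ] H) ((↑u : H →L[ℝ] H) f)‖ := by rw [h1]
      _ ≤ ‖(↑u⁻¹ : H →L[ℝ] H)‖ * ‖(↑u : H →L[ℝ] H) f‖ := ContinuousLinearMap.le_opNorm _ _
      _ ≤ _ := by gcongr; linarith
  rw [inv_mul_le_iff₀ (by positivity), ← mul_pow]
  gcongr

lemma aux_low (B : H →L[ℝ] H) (hs : ∀ f g, ⟪B f, g⟫_ℝ = ⟪f, B g⟫_ℝ) (δ : ℝ) (hδ : 0 < δ)
    (hu : ∀ t : ℝ, |t| < δ → IsUnit (B - t • (1 : H →L[ℝ] H))) (f : H) :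
    δ ^ 2 * ‖f‖ ^ 2 ≤ ‖B f‖ ^ 2 := by
  rcases eq_or_ne f 0 with rfl | hf
  · simp
  set S : Set ℝ := {t | ∀ f, t * ‖f‖ ^ 2 ≤ ‖B f‖ ^ 2} with hS
  have h0 : (0:ℝ) ∈ S := by intro f; simp
  have hbdd : BddAbove S := by
    refine ⟨‖B f‖ ^ 2 / ‖f‖ ^ 2, fun t ht => ?_⟩
    rw [le_div_iff₀ (by positivity)]
    exact ht f
  set u := sSup S with hu'
  have hu0 : 0 ≤ u := le_csSup hbdd h0
  have huS : u ∈ S := by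
    intro g
    rcases eq_or_ne g 0 with rfl | hg
    · simp
    rw [← le_div_iff₀ (by positivity)]
    refine csSup_le ⟨0, h0⟩ fun t ht => ?_
    rw [le_div_iff₀ (by positivity)]
    exact ht g
  by_cases hlt : δ ^ 2 ≤ u
  · calc _ ≤ u * ‖f‖ ^ 2 := by gcongr
      _ ≤ _ := huS f
  exfalso
  push Not at hlt
  set r := √u with hr
  have hr0 : 0 ≤ r := Real.sqrt_nonneg _
  have hr2 : r ^ 2 = u := Real.sq_sqrt hu0
  have hrδ : r < δ := by nlinarith
  have u1 := hu r (by rwa [abs_of_nonneg hr0])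
  have u2 := hu (-r) (by rwa [abs_neg, abs_of_nonneg hr0])
  obtain ⟨κ, hκ, hk⟩ := aux_unit _ (u1.mul u2)
  set C := (B - r • (1 : H →L[ℝ] H)) * (B - (-r) • (1 : H →L[ℝ] H)) with hC
  have hCf : ∀ f, C f = B (B f) - u • f := by
    intro f
    rw [← hr2]
    simp [hC, pow_two, mul_smul, smul_add]
    abel
  have hform : ∀ f, ⟪C f, f⟫_ℝ = ‖B f‖ ^ 2 - u * ‖f‖ ^ 2 := by
    intro f
    rw [hCf, inner_sub_left, hs, real_inner_smul_left, real_inner_self_eq_norm_sq,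
      real_inner_self_eq_norm_sq]
  have hsym : ∀ f g, ⟪C f, g⟫_ℝ = ⟪f, C g⟫_ℝ := by
    intro f g
    rw [hCf, hCf, inner_sub_left, inner_sub_right, hs, hs, real_inner_smul_left,
      real_inner_smul_right]
  have hpos : ∀ f, 0 ≤ ⟪C f, f⟫_ℝ := by
    intro f
    rw [hform]; linarith [huS f]
  have : u + κ / (‖C‖ + 1) ∈ S := by
    intro f
    have h1 := aux_sq C hsym hpos f
    have h2 := hk f
    have h3 : κ * ‖f‖ ^ 2 ≤ (‖C‖ + 1) * ⟪C f, f⟫_ℝ := by nlinarith [hpos f]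
    rw [hform] at h3
    have : κ / (‖C‖ + 1) * ‖f‖ ^ 2 ≤ ‖B f‖ ^ 2 - u * ‖f‖ ^ 2 := by
      rw [div_mul_eq_mul_div, div_le_iff₀ (by positivity)]; linarith
    linarith
  have h4 := le_csSup hbdd this
  have : 0 < κ / (‖C‖ + 1) := by positivity
  linarith

lemma aux_gap [CompleteSpace H] (A : H →L[ℝ] H) (hs : ∀ f g, ⟪A f, g⟫_ℝ = ⟪f, A g⟫_ℝ)
    (hpos : ∀ f, 0 ≤ ⟪A f, f⟫_ℝ) (e : H) (hker : ∀ f, A f = 0 → ∃ r : ℝ, f = r • e)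
    (ε : ℝ) (hε : 0 < ε)
    (hu : ∀ t : ℝ, 0 < t → t < ε → IsUnit (A - t • (1 : H →L[ℝ] H))) (h : H)
    (hh : ⟪e, h⟫_ℝ = 0) : ε * ‖h‖ ^ 2 ≤ ⟪A h, h⟫_ℝ := by
  have h1 : ∀ g, ε * ⟪A g, g⟫_ℝ ≤ ‖A g‖ ^ 2 := by
    intro g
    have := aux_low (A - (ε/2) • (1 : H →L[ℝ] H)) (by
      intro f g
      simp [inner_sub_left, inner_sub_right, hs, real_inner_smul_left,
      real_inner_smul_right]) (ε/2) (by positivity) (by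
      intro t ht
      rw [abs_lt] at ht
      rw [sub_sub, ← add_smul]
      exact hu _ (by linarith) (by linarith)) g
    simp only [_root_.sub_apply, _root_.smul_apply,
      one_apply_eq_self] at this
    rw [norm_sub_sq_real, norm_smul, real_inner_smul_right, mul_pow] at this
    simp only [Real.norm_eq_abs, sq_abs] at this
    linarith
  have h2 : ∀ g, ε * ‖A g‖ ^ 2 ≤ ⟪A (A g), A g⟫_ℝ := by
    intro g
    have c := aux_cs A hs hpos g (A g)
    rw [real_inner_self_eq_norm_sq] at c
    rcases eq_or_ne (A g) 0 with h0 | h0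
    · simp [h0]
    have hp : 0 < ‖A g‖ ^ 2 := by positivity
    have := mul_le_mul_of_nonneg_right (h1 g) (hpos (A g))
    refine le_of_mul_le_mul_right (a := ‖A g‖ ^ 2) ?_ hp
    nlinarith
  have hcl : h ∈ closure (Set.range A) := by
    have : h ∈ (LinearMap.range A.toLinearMap).topologicalClosure := by
      rw [← Submodule.orthogonal_orthogonal_eq_closure, Submodule.mem_orthogonal]
      intro f hf
      rw [Submodule.mem_orthogonal] at hf
      have : A f = 0 := by
        have := hf (A (A f)) ⟨A f, rfl⟩
        rw [hs, real_inner_self_eq_norm_sq] at this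
        simpa using this
      obtain ⟨r, rfl⟩ := hker f this
      rw [real_inner_smul_left, hh, mul_zero]
    exact this
  have hclosed : IsClosed {h : H | ε * ‖h‖ ^ 2 ≤ ⟪A h, h⟫_ℝ} :=
    isClosed_le (by fun_prop) (by fun_prop)
  exact closure_minimal (by rintro _ ⟨g, rfl⟩; exact h2 g) hclosed hcl

end abstractHilbert


lemma aux_summable (α : ℝ) (hα1 : α < 1) (c : ℕ → ℝ)
    (hc : ∀ x ≥ 1, 0 < c x ∧ c x < 1 / 2)
    (hliminf : ∃ c₀ > 0, ∀ᶠ x : ℕ in atTop, c₀ ≤ c x * (x : ℝ) ^ α)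
    (a : ℕ → ℝ) (ha : ∀ x, 0 < a x)
    (hrec : ∀ x, a (x + 1) * (1 / 2 + c (x + 1)) = a x * (1 / 2 - c (x + 1))) : Summable a := by
  obtain ⟨c₀, hc₀, h⟩ := hliminf
  -- eventually 1/x ≤ c x
  have h1 : ∀ᶠ x : ℕ in atTop, 1 ≤ c x * x := by
    have ht : Tendsto (fun x : ℕ => (x : ℝ) ^ (1 - α)) atTop atTop :=
      (tendsto_rpow_atTop (by linarith)).comp tendsto_natCast_atTop_atTop
    filter_upwards [h, ht.eventually_ge_atTop (1 / c₀), eventually_ge_atTop 1] with x hx hx2 hx1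
    have hx0 : (0:ℝ) < x := by exact_mod_cast hx1
    have e : (x:ℝ) = (x:ℝ) ^ α * (x:ℝ) ^ (1 - α) := by
      rw [← Real.rpow_add hx0]; simp
    rw [e, ← mul_assoc]
    calc 1 = c₀ * (1 / c₀) := by field_simp
      _ ≤ _ := by
        have := (hc x hx1).1
        gcongr
  obtain ⟨N, hN⟩ := eventually_atTop.1 h1
  -- Kummer telescoping
  have key : ∀ x ≥ N, a x ≤ x * a x - (x + 1 : ℕ) * a (x + 1) := by
    intro x hx
    have h2 := hN (x + 1) (by omega)
    have h3 := hrec x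
    obtain ⟨h4, h5⟩ := hc (x + 1) (by omega)
    have hax := ha x
    have hax' := ha (x + 1)
    have h6 : a (x + 1) ≤ a x * (1 - 2 * c (x+1)) := by nlinarith
    push_cast at *
    have h7 : (x + 1 : ℝ) * a (x+1) ≤ (x + 1 : ℝ) * (a x * (1 - 2 * c (x+1))) := by gcongr
    nlinarith
  rw [← summable_nat_add_iff N]
  refine summable_of_sum_range_le (c := N * a N) (fun n => (ha _).le) fun n => ?_
  have : ∀ n : ℕ, ∑ i ∈ Finset.range n, a (i + N) ≤ N * a N - (n + N : ℕ) * a (n + N) := by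
    intro n
    induction n with
    | zero => simp
    | succ n ih =>
      rw [Finset.sum_range_succ]
      have := key (n + N) (by omega)
      rw [show n + 1 + N = n + N + 1 by ring]
      linarith
  have h2 := this n
  have h3 : 0 ≤ ((n + N : ℕ) : ℝ) * a (n + N) := mul_nonneg (Nat.cast_nonneg _) (ha _).le
  linarith

lemma aux_tail (π : ℕ → ℝ) (hpos : ∀ x, 0 < π x) (hsum : HasSum π 1)
    (hr : Tendsto (fun n => π (n + 1) / π n) atTop (nhds 1)) (ε : ℝ) (hε : 0 < ε) :
    ∃ n ≥ 1, π n < ε * ((1 - ∑ i ∈ Finset.range n, π i) * ∑ i ∈ Finset.range n, π i) := by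
  have h1 : ∀ k, Tendsto (fun n => π (n + k) / π n) atTop (nhds 1) := by
    intro k
    induction k with
    | zero =>
      refine tendsto_const_nhds.congr fun n => ?_
      rw [Nat.add_zero, div_self (hpos n).ne']
    | succ k ih =>
      have h := (hr.comp (tendsto_add_atTop_nat k)).mul ih
      rw [one_mul] at h
      refine h.congr fun n => ?_
      have := (hpos (n + k)).ne'
      have := (hpos n).ne'
      simp only [Function.comp]
      rw [show n + (k + 1) = n + k + 1 by ring]
      field_simp
  obtain ⟨K, hK⟩ := exists_nat_gt (2 / ε)
  have h2 : Tendsto (fun n => ∑ k ∈ Finset.range K, π (n + k) / π n) atTop (nhds K) := by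
    have := tendsto_finsetSum (Finset.range K) (fun k _ => h1 k)
    simpa using this
  have h3 := h2.eventually (lt_mem_nhds hK)
  have h4 := hsum.tendsto_sum_nat.eventually (lt_mem_nhds (show (1/2 : ℝ) < 1 by norm_num))
  obtain ⟨n, h3, h4, hn⟩ := (h3.and (h4.and (eventually_ge_atTop 1))).exists
  refine ⟨n, hn, ?_⟩
  rw [← Finset.sum_div, lt_div_iff₀ (hpos n)] at h3
  have h5 : ∑ i ∈ Finset.range (n + K), π i ≤ 1 := by
    exact sum_le_hasSum _ (fun i _ => (hpos i).le) hsum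
  rw [Finset.sum_range_add] at h5
  set s := ∑ i ∈ Finset.range n, π i
  have h6 : 2 / ε * π n < 1 - s := by linarith
  have h7 : 2 * π n < ε * (1 - s) := by
    rw [div_mul_eq_mul_div, div_lt_iff₀ hε] at h6; linarith
  have h8 : 0 < 1 - s := by have := hpos n; have : 0 < 2 / ε * π n := by positivity
                            linarith
  have : 0 < ε * (1 - s) := by positivity
  nlinarith

open MeasureTheory

lemma aux_mu (π : ℕ → ℝ)
    (μ : Measure ℕ)
    (hμ : μ = Measure.count.withDensity fun x => ENNReal.ofReal (π x)) (x : ℕ) :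
    μ {x} = ENNReal.ofReal (π x) := by
  rw [hμ, withDensity_apply _ (measurableSet_singleton x)]
  simp

lemma aux_eq (π : ℕ → ℝ) (hpos : ∀ x, 0 < π x)
    (μ : Measure ℕ) (hμx : ∀ x, μ {x} = ENNReal.ofReal (π x)) {f g : ℕ → ℝ} (h : f =ᵐ[μ] g) :
    f = g := by
  funext x
  by_contra hx
  have h1 : μ {x} ≤ μ {y | ¬ (f y = g y)} := measure_mono (by simpa using hx)
  rw [show μ {y | ¬ (f y = g y)} = 0 from h, hμx] at h1
  have := hpos x
  simp at h1
  linarith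

lemma aux_hasSum (π : ℕ → ℝ) (hpos : ∀ x, 0 < π x)
    (μ : Measure ℕ)
    (hμ : μ = Measure.count.withDensity fun x => ENNReal.ofReal (π x))
    (f g : Lp ℝ 2 μ) : HasSum (fun x => π x * (f x * g x)) ⟪f, g⟫_ℝ := by
  have hi := L2.integrable_inner (𝕜 := ℝ) f g
  have hμx := aux_mu π μ hμ
  rw [L2.inner_def]
  have h1 := hasSum_integral_iUnion (μ := μ) (f := fun a => ⟪f a, g a⟫_ℝ) (s := fun x : ℕ => {x})
    (fun x => measurableSet_singleton x)
    (by intro x y hxy; simpa [Function.onFun] using hxy) hi.integrableOn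
  rw [Set.iUnion_of_singleton, setIntegral_univ] at h1
  refine (congrArg (fun F : ℕ → ℝ => HasSum F (∫ x, ⟪f x, g x⟫_ℝ ∂μ)) (funext fun x => ?_)).mpr h1
  rw [integral_singleton, Measure.real, hμx, ENNReal.toReal_ofReal (hpos x).le, smul_eq_mul]
  simp [mul_comm]

lemma aux_shift (u v : ℕ → ℝ) (s : ℝ) (h : HasSum (fun x => u x + v x) s) (hu : Summable u)
    (hv : v 0 = 0) : HasSum (fun x => u x + v (x + 1)) s := by
  have h1 : HasSum v (s - ∑' x, u x) := by
    have := h.sub hu.hasSum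
    simpa using this
  have h2 := (hasSum_nat_add_iff' 1).2 h1
  simp only [Finset.range_one, Finset.sum_singleton, hv, sub_zero] at h2
  have := hu.hasSum.add h2
  simpa using this

lemma aux_P (p q : ℕ → ℝ) (pm : ℕ → ℕ → ℝ)
    (hpm : ∀ x y, pm x y = if y = x + 1 then p x else if y + 1 = x then q x else 0)
    (f : ℕ → ℝ) (x : ℕ) : ∑' y, pm x y * f y =
      p x * f (x + 1) + (match x with | 0 => 0 | n + 1 => q (n + 1) * f n) := by
  rcases x with _ | n
  · rw [tsum_eq_single 1]
    · simp [hpm]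
    · intro y hy
      simp [hpm, hy]
  · rw [tsum_eq_sum (s := {n + 2, n})]
    · rw [Finset.sum_pair (by omega)]
      simp [hpm]
      intro h
      omega
    · intro y hy
      simp only [Finset.mem_insert, Finset.mem_singleton, not_or] at hy
      rw [hpm, if_neg (by omega), if_neg (by omega), zero_mul]

lemma aux_dir (π : ℕ → ℝ) (hpos : ∀ x, 0 < π x)
    (μ : Measure ℕ)
    (hμ : μ = Measure.count.withDensity fun x => ENNReal.ofReal (π x))
    (p q : ℕ → ℝ) (hp0 : p 0 = 1) (hpq : ∀ x, p (x + 1) + q (x + 1) = 1)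
    (hp : ∀ x, 0 < p x) (hq : ∀ x, 0 < q (x + 1))
    (hbal : ∀ x, π x * p x = π (x + 1) * q (x + 1))
    (pm : ℕ → ℕ → ℝ)
    (hpm : ∀ x y, pm x y = if y = x + 1 then p x else if y + 1 = x then q x else 0)
    (P : Lp ℝ 2 μ →L[ℝ] Lp ℝ 2 μ)
    (hP : ∀ f : Lp ℝ 2 μ, ∀ x : ℕ, P f x = ∑' y, pm x y * f y)
    (f g : Lp ℝ 2 μ) :
    HasSum (fun x => π x * p x * ((f (x + 1) - f x) * (g (x + 1) - g x))) ⟪(1 - P) f, g⟫_ℝ := by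
  have hp1 : ∀ x, p x ≤ 1 := by
    intro x
    rcases x with _ | x
    · exact hp0.le
    · linarith [hpq x, hq x]
  have hfg := aux_hasSum π hpos μ hμ f g
  have hff := aux_hasSum π hpos μ hμ f f
  have hgg := aux_hasSum π hpos μ hμ g g
  have hPfg := aux_hasSum π hpos μ hμ (P f) g
  have s1 := aux_shift (fun x => π x * p x * (f x * g x))
    (fun x => match x with | 0 => 0 | n + 1 => π (n + 1) * q (n + 1) * (f (n + 1) * g (n + 1)))
    ⟪f, g⟫_ℝ (by
      convert hfg using 2 with x
      rcases x with _ | x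
      · simp [hp0]
      · simp only
        rw [← add_mul, ← mul_add, hpq, mul_one]) (by
      refine Summable.of_norm_bounded (summable_abs_iff.2 hfg.summable) fun x => ?_
      rw [Real.norm_eq_abs, mul_right_comm, abs_mul, abs_of_pos (hp x)]
      exact mul_le_of_le_one_right (abs_nonneg _) (hp1 x)) rfl
  have s2 := aux_shift (fun x => π x * p x * (f (x + 1) * g x))
    (fun x => match x with | 0 => 0 | n + 1 => π (n + 1) * q (n + 1) * (f n * g (n + 1)))
    ⟪P f, g⟫_ℝ (by
      convert hPfg using 2 with x
      rw [hP, aux_P p q pm hpm]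
      rcases x with _ | x
      · simp; ring
      · simp only
        ring) (by
      refine Summable.of_norm_bounded (((summable_nat_add_iff 1).2 hff.summable).add hgg.summable)
        fun x => ?_
      have e1 : π x * p x * f (x+1) ^ 2 ≤ π (x+1) * (f (x+1) * f (x+1)) := by
        rw [hbal, ← pow_two]
        have := hpos (x+1)
        have : π (x+1) * q (x+1) ≤ π (x+1) := by nlinarith [hpq x, hp (x+1)]
        gcongr
      have e2 : π x * p x * g x ^ 2 ≤ π x * (g x * g x) := by
        rw [← pow_two]
        have := hpos x
        have : π x * p x ≤ π x := by nlinarith [hp1 x]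
        gcongr
      have hpp : 0 < π x * p x := mul_pos (hpos x) (hp x)
      rw [Real.norm_eq_abs, abs_mul, abs_of_pos hpp]
      have e3 : |f (x+1) * g x| ≤ f (x+1) ^ 2 + g x ^ 2 := by
        rw [abs_le]; constructor <;>
        nlinarith [sq_nonneg (f (x+1) + g x), sq_nonneg (f (x+1) - g x),
          sq_nonneg (f (x+1)), sq_nonneg (g x)]
      calc _ ≤ π x * p x * (f (x+1) ^ 2 + g x ^ 2) := by gcongr
        _ ≤ _ := by linarith) rfl
  have h := s1.sub s2
  rw [← inner_sub_left] at h
  refine (congrArg (fun F : ℕ → ℝ => HasSum F (⟪f - P f, g⟫_ℝ)) (funext fun x => ?_)).mpr h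
  simp only
  rw [← hbal]
  ring

theorem stmt12 (α : ℝ) (hα0 : 0 < α) (hα1 : α < 1) (c : ℕ → ℝ)
    (hc : ∀ x ≥ 1, 0 < c x ∧ c x < 1 / 2)
    (hliminf : ∃ c₀ > 0, ∀ᶠ x : ℕ in atTop, c₀ ≤ c x * (x : ℝ) ^ α)
    (hlimsup : ∃ C : ℝ, ∀ᶠ x : ℕ in atTop, c x * (x : ℝ) ^ α ≤ C)
    (p q : ℕ → ℝ) (hp0 : p 0 = 1)
    (hp : ∀ x ≥ 1, p x = 1 / 2 - c x)
    (hq : ∀ x ≥ 1, q x = 1 / 2 + c x)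
    (pm : ℕ → ℕ → ℝ)
    (hpm : ∀ x y, pm x y = if y = x + 1 then p x else if y + 1 = x then q x else 0)
    (πt : ℕ → ℝ)
    (hπt : ∀ x, πt x = ∏ k ∈ Finset.Icc 1 x, p (k - 1) / q k)
    (π : ℕ → ℝ) (hπ : ∀ x, π x = πt x / ∑' y, πt y)
    (μ : MeasureTheory.Measure ℕ)
    (hμ : μ = MeasureTheory.Measure.count.withDensity fun x => ENNReal.ofReal (π x))
    (P : MeasureTheory.Lp ℝ 2 μ →L[ℝ] MeasureTheory.Lp ℝ 2 μ)
    (hP : ∀ f : MeasureTheory.Lp ℝ 2 μ, ∀ x : ℕ, P f x = ∑' y, pm x y * f y) :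
    sSup {r : ℝ | ∃ f : MeasureTheory.Lp ℝ 2 μ,
        (∑' x, f x * π x) = 0 ∧ ‖f‖ = 1 ∧ r = ⟪P f, f⟫_ℝ} = 1 ∧
    (1 : ℝ) ∈ closure (spectrum ℝ P \ {1}) := by
  have hppos : ∀ x, 0 < p x := by
    intro x
    rcases x with _ | x
    · rw [hp0]; norm_num
    · rw [hp _ (by omega)]; linarith [(hc (x+1) (by omega)).2]
  have hqpos : ∀ x, 0 < q (x + 1) := by
    intro x
    rw [hq _ (by omega)]; linarith [(hc (x+1) (by omega)).1]
  have hpq : ∀ x, p (x + 1) + q (x + 1) = 1 := by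
    intro x
    rw [hq _ (by omega), hp _ (by omega)]; ring
  have hrec : ∀ x, πt (x + 1) = πt x * (p x / q (x + 1)) := by
    intro x
    rw [hπt, hπt, Finset.prod_Icc_succ_top (by omega)]
    simp
  have hπtpos : ∀ x, 0 < πt x := by
    intro x
    induction x with
    | zero => rw [hπt]; simp
    | succ n ih => rw [hrec]; exact mul_pos ih (div_pos (hppos n) (hqpos n))
  have hbalt : ∀ x, πt (x + 1) * q (x + 1) = πt x * p x := by
    intro x
    rw [hrec]; have := (hqpos x).ne'; field_simp
  have hsumt : Summable πt := by
    have h1 : Summable (fun x => πt x * p x) := by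
      refine aux_summable α hα1 c hc hliminf _ (fun x => mul_pos (hπtpos x) (hppos x)) fun x => ?_
      rw [← hq _ (by omega), ← hp _ (by omega)]
      linear_combination (p (x + 1)) * hbalt x
    rw [← summable_nat_add_iff 1]
    refine Summable.of_nonneg_of_le (fun x => (hπtpos _).le) (fun x => ?_) (h1.mul_left 2)
    rw [← hbalt, hq _ (by omega)]
    nlinarith [(hc (x+1) (by omega)).1, hπtpos (x+1)]
  have hZ : 0 < ∑' y, πt y := hsumt.tsum_pos (fun x => (hπtpos x).le) 0 (hπtpos 0)
  have hπpos : ∀ x, 0 < π x := fun x => by rw [hπ]; exact div_pos (hπtpos x) hZ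
  have hbal : ∀ x, π x * p x = π (x + 1) * q (x + 1) := by
    intro x
    rw [hπ, hπ, div_mul_eq_mul_div, div_mul_eq_mul_div, hbalt]
  have hπsum : HasSum π 1 := by
    have := hsumt.hasSum.div_const (∑' y, πt y)
    rw [div_self hZ.ne'] at this
    rwa [show π = fun x => πt x / ∑' y, πt y from funext hπ]
  have hc0 : Tendsto c atTop (nhds 0) := by
    obtain ⟨C, hC⟩ := hlimsup
    have ht : Tendsto (fun x : ℕ => C * (x : ℝ) ^ (-α)) atTop (nhds (C * 0)) :=
      ((tendsto_rpow_neg_atTop hα0).comp tendsto_natCast_atTop_atTop).const_mul C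
    rw [mul_zero] at ht
    refine tendsto_of_tendsto_of_tendsto_of_le_of_le' tendsto_const_nhds ht ?_ ?_
    · filter_upwards [eventually_ge_atTop 1] with x hx using (hc x hx).1.le
    · filter_upwards [eventually_ge_atTop 1, hC] with x hx hxC
      have hx0 : (0:ℝ) < x := by exact_mod_cast hx
      rw [Real.rpow_neg hx0.le, ← div_eq_mul_inv, le_div_iff₀ (Real.rpow_pos_of_pos hx0 _)]
      exact hxC
  have hratio : Tendsto (fun n => π (n + 1) / π n) atTop (nhds 1) := by
    have h1 : Tendsto (fun n => (1 / 2 - c n) / (1 / 2 + c (n + 1))) atTop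
        (nhds ((1 / 2 - 0) / (1 / 2 + 0))) :=
      (hc0.const_sub _).div ((hc0.comp (tendsto_add_atTop_nat 1)).const_add _) (by norm_num)
    norm_num at h1
    refine h1.congr' ?_
    filter_upwards [eventually_ge_atTop 1] with n hn
    rw [hπ, hπ, hrec, hp n hn, hq (n+1) (by omega)]
    have := (hπtpos n).ne'
    have := hZ.ne'
    field_simp
  have hμx := aux_mu π μ hμ
  have hμreal : ∀ x, μ.real {x} = π x := fun x => by
    rw [Measure.real, hμx, ENNReal.toReal_ofReal (hπpos x).le]
  have hprob : IsProbabilityMeasure μ := by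
    constructor
    rw [hμ, withDensity_apply _ MeasurableSet.univ, setLIntegral_univ, lintegral_count,
      ← ENNReal.ofReal_tsum_of_nonneg (fun x => (hπpos x).le) hπsum.summable, hπsum.tsum_eq]
    simp
  have hdir := aux_dir π hπpos μ hμ p q hp0 hpq hppos hqpos hbal pm hpm P hP
  set A : Lp ℝ 2 μ →L[ℝ] Lp ℝ 2 μ := 1 - P with hA
  have hApos : ∀ f, 0 ≤ ⟪A f, f⟫_ℝ := fun f =>
    (hdir f f).nonneg fun x => mul_nonneg (mul_pos (hπpos x) (hppos x)).le (mul_self_nonneg _)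
  have hAsym : ∀ f g, ⟪A f, g⟫_ℝ = ⟪f, A g⟫_ℝ := by
    intro f g
    rw [real_inner_comm (A g) f]
    refine (hdir f g).unique ?_
    convert hdir g f using 3 with x
    ring
  set I : ℕ → Lp ℝ 2 μ := fun n =>
    indicatorConstLp 2 (MeasurableSet.of_discrete (s := Set.Ici n)) (measure_ne_top μ _) (1:ℝ) with hI
  have hIx : ∀ n, (I n : ℕ → ℝ) = (Set.Ici n).indicator fun _ => (1:ℝ) := fun n =>
    aux_eq π hπpos μ hμx indicatorConstLp_coeFn
  have hII : ∀ m n, ⟪I m, I n⟫_ℝ = μ.real (Set.Ici m ∩ Set.Ici n) := fun m n => by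
    exact L2.real_inner_indicatorConstLp_one_indicatorConstLp_one _ _ _ _
  have hT : ∀ n, μ.real (Set.Ici n) = 1 - ∑ i ∈ Finset.range n, π i := by
    intro n
    have h1 : Set.Ici n = ((Finset.range n : Finset ℕ) : Set ℕ)ᶜ := by
      ext; simp
    rw [h1, probReal_compl_eq_one_sub (by exact MeasurableSet.of_discrete),
      ← sum_measureReal_singleton]
    simp [hμreal]
  have hinner : ∀ f : Lp ℝ 2 μ, ⟪I 0, f⟫_ℝ = ∑' x, f x * π x := by
    intro f
    rw [← (aux_hasSum π hπpos μ hμ (I 0) f).tsum_eq]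
    refine tsum_congr fun x => ?_
    rw [hIx]; simp [mul_comm]
  have htest : ∀ ε : ℝ, 0 < ε → ∃ h : Lp ℝ 2 μ, ⟪I 0, h⟫_ℝ = 0 ∧ ⟪A h, h⟫_ℝ < ε * ‖h‖ ^ 2 := by
    intro ε hε
    obtain ⟨n, hn, hlt⟩ := aux_tail π hπpos hπsum hratio ε hε
    obtain ⟨m, rfl⟩ : ∃ m, n = m + 1 := ⟨n - 1, by omega⟩
    set T := μ.real (Set.Ici (m + 1)) with hTd
    have h00 : ⟪I 0, I 0⟫_ℝ = 1 := by rw [hII]; simp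
    have h01 : ⟪I 0, I (m+1)⟫_ℝ = T := by rw [hII]; simp [hTd]
    have h10 : ⟪I (m+1), I 0⟫_ℝ = T := by rw [hII]; simp [hTd]
    have h11 : ⟪I (m+1), I (m+1)⟫_ℝ = T := by rw [hII]; simp [hTd]
    set h := I (m+1) - T • I 0 with hh
    have hhx : ∀ x, h x = (if m + 1 ≤ x then 1 else 0) - T := by
      have e1 : (h : ℕ → ℝ) = (I (m+1) : ℕ → ℝ) - ((T • I 0 : Lp ℝ 2 μ) : ℕ → ℝ) :=
        aux_eq π hπpos μ hμx (Lp.coeFn_sub _ _)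
      have e2 : ((T • I 0 : Lp ℝ 2 μ) : ℕ → ℝ) = T • (I 0 : ℕ → ℝ) :=
        aux_eq π hπpos μ hμx (Lp.coeFn_smul _ _)
      intro x
      rw [e1, e2, hIx, hIx]
      simp [Set.indicator_apply]
    refine ⟨h, ?_, ?_⟩
    · rw [hh, inner_sub_right, real_inner_smul_right, h00, h01]; ring
    · have e1 : ⟪A h, h⟫_ℝ = π m * p m := by
        refine (hdir h h).unique ?_
        have := hasSum_single (f := fun x => π x * p x * ((h (x + 1) - h x) * (h (x + 1) - h x))) m
          (by
            intro x hx
            have : h (x+1) = h x := by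
              rw [hhx, hhx]
              congr 2
              simp; omega
            rw [this]; simp)
        convert this using 1
        simp [hhx]
      have e2 : ‖h‖ ^ 2 = T - T ^ 2 := by
        rw [← real_inner_self_eq_norm_sq, hh]
        simp only [inner_sub_left, inner_sub_right, real_inner_smul_left, real_inner_smul_right,
          h00, h01, h10, h11]
        ring
      have e3 := hT (m+1)
      rw [e1, e2, hbal]
      have e4 : π (m+1) * q (m+1) ≤ π (m+1) := by
        nlinarith [hpq m, hppos (m+1), hπpos (m+1)]
      have e5 : ∑ i ∈ Finset.range (m+1), π i = 1 - T := by linarith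
      rw [e5] at hlt
      nlinarith
  have hAP : ∀ f : Lp ℝ 2 μ, ⟪P f, f⟫_ℝ = ‖f‖ ^ 2 - ⟪A f, f⟫_ℝ := by
    intro f
    have : A f = f - P f := rfl
    rw [this, inner_sub_left, real_inner_self_eq_norm_sq]
    ring
  have hnorm : ∀ ε : ℝ, 0 < ε → ∃ f : Lp ℝ 2 μ, (∑' x, f x * π x) = 0 ∧ ‖f‖ = 1 ∧
      1 - ε < ⟪P f, f⟫_ℝ := by
    intro ε hε
    obtain ⟨h, h1, h2⟩ := htest ε hε
    have h0 : 0 < ‖h‖ := by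
      rw [norm_pos_iff]
      rintro rfl
      simp at h2
    have hn1 : ‖‖h‖⁻¹ • h‖ = 1 := by
      rw [norm_smul, norm_inv, norm_norm, inv_mul_cancel₀ h0.ne']
    refine ⟨‖h‖⁻¹ • h, ?_, hn1, ?_⟩
    · rw [← hinner, real_inner_smul_right, h1, mul_zero]
    · rw [hAP, hn1, map_smul, real_inner_smul_left, real_inner_smul_right]
      have : ‖h‖⁻¹ * (‖h‖⁻¹ * ⟪A h, h⟫_ℝ) < ε := by
        rw [← mul_assoc, ← mul_inv, inv_mul_lt_iff₀ (by positivity)]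
        nlinarith
      linarith
  constructor
  · refine csSup_eq_of_forall_le_of_forall_lt_exists_gt ?_ ?_ ?_
    · obtain ⟨f, h1, h2, _⟩ := hnorm 1 one_pos
      exact ⟨_, f, h1, h2, rfl⟩
    · rintro _ ⟨f, -, h2, rfl⟩
      rw [hAP, h2]
      linarith [hApos f]
    · intro w hw
      obtain ⟨f, h1, h2, h3⟩ := hnorm (1 - w) (by linarith)
      exact ⟨_, ⟨f, h1, h2, rfl⟩, by linarith⟩
  · by_contra hcl
    rw [Metric.mem_closure_iff] at hcl
    push Not at hcl
    obtain ⟨ε, hε, hcl⟩ := hcl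
    have hker : ∀ f, A f = 0 → ∃ r : ℝ, f = r • I 0 := by
      intro f hf
      have h1 := hdir f f
      rw [hf, inner_zero_left] at h1
      have h2 := (hasSum_zero_iff_of_nonneg (fun x =>
        mul_nonneg (mul_pos (hπpos x) (hppos x)).le (mul_self_nonneg _))).1 h1
      have h3 : ∀ x, f (x + 1) = f x := by
        intro x
        have := congrFun h2 x
        simp only [Pi.zero_apply, mul_eq_zero, (hπpos x).ne', (hppos x).ne', false_or, or_self]
          at this
        linarith
      have h4 : ∀ x, f x = f 0 := by
        intro x
        induction x with
        | zero => rfl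
        | succ n ih => rw [h3, ih]
      refine ⟨f 0, Lp.ext ?_⟩
      have e2 : ((f 0 • I 0 : Lp ℝ 2 μ) : ℕ → ℝ) = f 0 • (I 0 : ℕ → ℝ) :=
        aux_eq π hπpos μ hμx (Lp.coeFn_smul _ _)
      rw [e2, hIx]
      refine Eventually.of_forall fun x => ?_
      simp [h4 x]
    obtain ⟨h, h1, h2⟩ := htest ε hε
    have := aux_gap A hAsym hApos (I 0) hker ε hε (by
      intro t ht0 ht
      by_contra hnu
      have hsp : (1 - t) ∈ spectrum ℝ P := by
        rw [spectrum.mem_iff]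
        convert hnu using 2
        rw [hA, Algebra.algebraMap_eq_smul_one, sub_smul, one_smul]
        abel
      have := hcl (1 - t) ⟨hsp, by simp; linarith⟩
      rw [Real.dist_eq, sub_sub_cancel, abs_of_pos ht0] at this
      linarith) h h1
    linarith
end
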